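/- Let H be a Hopf algebra over a field k, C a k-coalgebra, A a unital k-algebra, and (−,−): A ⊗ C → k a non-degenerate dual pairing. Suppose λ: C → H ⊗ C, λ(c) = c⁽⁻¹⁾ ⊗ c⁽⁰⁾, and ρ: A → A ⊗ H, ρ(a) = a⁽⁰⁾ ⊗ a⁽¹⁾, are linear maps satisfying (a⁽⁰⁾, c)a⁽¹⁾ = c⁽⁻¹⁾(a, c⁽⁰⁾) in H for all a ∈ A, c ∈ C. Then ρ makes A a symmetric right partial H-comodule algebra if and only if λ makes C a symmetric left partial H-comodule coalgebra. -/

import Mathlib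

open TensorProduct

/-- A symmetric right partial coaction of a Hopf algebra `K` on a unital algebra `A`:
(PRHCA1) `ρ(ab) = ρ(a)ρ(b)`; (PRHCA2) `(id ⊗ ε)ρ(a) = a`;
(PRHCA3) `(ρ ⊗ id)ρ(a) = [(id ⊗ Δ)ρ(a)](ρ(1) ⊗ 1)`;
(PRHCA4) `(ρ ⊗ id)ρ(a) = (ρ(1) ⊗ 1)[(id ⊗ Δ)ρ(a)]`. -/
structure IsSymmRightPartialCoaction (k : Type*) [Field k] {K A : Type*}
    [Ring K] [HopfAlgebra k K] [Ring A] [Algebra k A] (ρ : A →ₗ[k] A ⊗[k] K) : Prop where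
  prhca1 : ∀ a b : A, ρ (a * b) = ρ a * ρ b
  prhca2 : ∀ a : A,
    (TensorProduct.rid k A) ((TensorProduct.map LinearMap.id Coalgebra.counit) (ρ a)) = a
  prhca3 : ∀ a : A, (TensorProduct.map ρ LinearMap.id) (ρ a) =
    ((TensorProduct.assoc k A K K).symm
      ((TensorProduct.map LinearMap.id (Coalgebra.comul (R := k))) (ρ a))) * (ρ 1 ⊗ₜ[k] (1 : K))
  prhca4 : ∀ a : A, (TensorProduct.map ρ LinearMap.id) (ρ a) =
    (ρ 1 ⊗ₜ[k] (1 : K)) * ((TensorProduct.assoc k A K K).symm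
      ((TensorProduct.map LinearMap.id (Coalgebra.comul (R := k))) (ρ a)))
/-- A dual pairing `(-,-) : A ⊗ C → k` between a unital algebra `A` and a coalgebra `C`:
`(ab,c) = ∑ (a,c₍₁₎)(b,c₍₂₎)` and `(1,c) = ε(c)`. -/
structure IsAlgCoalgPairing (k : Type*) [Field k] {A C : Type*} [Ring A] [Algebra k A]
    [AddCommGroup C] [Module k C] [Coalgebra k C] (q : A →ₗ[k] C →ₗ[k] k) : Prop where
  pair_mul : ∀ (a b : A) (c : C), q (a * b) c =
    (TensorProduct.lid k k) (TensorProduct.map (q a) (q b) (Coalgebra.comul (R := k) c))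
  pair_one : ∀ c : C, q 1 c = Coalgebra.counit c
/-- The map `H ⊗ C → H`, `x ⊗ c ↦ ε(c)x`. -/
noncomputable def psiHC (k : Type*) [Field k] {H C : Type*}
    [AddCommGroup H] [Module k H]
    [AddCommGroup C] [Module k C] [Coalgebra k C] : H ⊗[k] C →ₗ[k] H :=
  (TensorProduct.rid k H).toLinearMap ∘ₗ TensorProduct.map LinearMap.id Coalgebra.counit

/-- The map `H ⊗ (H ⊗ M) → H ⊗ M`, `x ⊗ (y ⊗ m) ↦ xy ⊗ m`. -/
noncomputable def mulFirst (k : Type*) [Field k] {H M : Type*} [Ring H] [Algebra k H]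
    [AddCommGroup M] [Module k M] : H ⊗[k] (H ⊗[k] M) →ₗ[k] H ⊗[k] M :=
  TensorProduct.map (LinearMap.mul' k H) LinearMap.id ∘ₗ
    (TensorProduct.assoc k H H M).symm.toLinearMap

/-- A left partial `H`-comodule coalgebra over a bialgebra `H`:
(PLHCC1) `(id ⊗ Δ)λ(c) = ∑ c₍₁₎⁽⁻¹⁾c₍₂₎⁽⁻¹⁾ ⊗ c₍₁₎⁽⁰⁾ ⊗ c₍₂₎⁽⁰⁾`;
(PLHCC2) `(ε ⊗ id)λ(c) = c`;
(PLHCC3) `(id ⊗ λ)λ(c) = ∑ c₍₁₎⁽⁻¹⁾ε(c₍₁₎⁽⁰⁾)(c₍₂₎⁽⁻¹⁾)₍₁₎ ⊗ (c₍₂₎⁽⁻¹⁾)₍₂₎ ⊗ c₍₂₎⁽⁰⁾`. -/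
structure IsPartialComoduleCoalgebra (k : Type*) [Field k] {H C : Type*} [Ring H] [Bialgebra k H]
    [AddCommGroup C] [Module k C] [Coalgebra k C] (lam : C →ₗ[k] H ⊗[k] C) : Prop where
  plhcc1 : ∀ c : C,
    TensorProduct.map LinearMap.id (Coalgebra.comul (R := k)) (lam c) =
    TensorProduct.map (LinearMap.mul' k H) LinearMap.id
      ((TensorProduct.tensorTensorTensorComm k H C H C)
        (TensorProduct.map lam lam (Coalgebra.comul (R := k) c)))
  plhcc2 : ∀ c : C,
    (TensorProduct.lid k C) (TensorProduct.map Coalgebra.counit LinearMap.id (lam c)) = c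
  plhcc3 : ∀ c : C,
    TensorProduct.map LinearMap.id lam (lam c) =
    mulFirst k (TensorProduct.map (psiHC k)
      ((TensorProduct.assoc k H H C).toLinearMap ∘ₗ
        TensorProduct.map (Coalgebra.comul (R := k)) LinearMap.id)
      (TensorProduct.map lam lam (Coalgebra.comul (R := k) c)))

/-- The symmetric axiom (PLHCC3') for a left partial `H`-comodule coalgebra:
`(id ⊗ λ)λ(c) = ∑ (c₍₁₎⁽⁻¹⁾)₍₁₎c₍₂₎⁽⁻¹⁾ε(c₍₂₎⁽⁰⁾) ⊗ (c₍₁₎⁽⁻¹⁾)₍₂₎ ⊗ c₍₁₎⁽⁰⁾`. -/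
def PLHCC3' (k : Type*) [Field k] {H C : Type*} [Ring H] [Bialgebra k H]
    [AddCommGroup C] [Module k C] [Coalgebra k C] (lam : C →ₗ[k] H ⊗[k] C) : Prop :=
  ∀ c : C,
    TensorProduct.map LinearMap.id lam (lam c) =
    mulFirst k ((TensorProduct.map LinearMap.id
        (TensorProduct.comm k (H ⊗[k] C) H).toLinearMap)
      ((TensorProduct.assoc k H (H ⊗[k] C) H)
        (TensorProduct.map
          ((TensorProduct.assoc k H H C).toLinearMap ∘ₗ
            TensorProduct.map (Coalgebra.comul (R := k)) LinearMap.id)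
          (psiHC k)
          (TensorProduct.map lam lam (Coalgebra.comul (R := k) c)))))

section PairingSeparation

variable {k : Type*} [Field k] {A C M N : Type*} [AddCommGroup A] [Module k A]
  [AddCommGroup C] [Module k C] [AddCommGroup M] [Module k M] [AddCommGroup N] [Module k N]

/-- The contraction `A ⊗ M → M`, `a ⊗ m ↦ (a, c)m`. -/
noncomputable def pairLeft (q : A →ₗ[k] C →ₗ[k] k) (M : Type*) [AddCommGroup M] [Module k M]
    (c : C) : A ⊗[k] M →ₗ[k] M :=
  (TensorProduct.lid k M).toLinearMap ∘ₗ TensorProduct.map (q.flip c) LinearMap.id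

/-- The contraction `M ⊗ C → M`, `m ⊗ c ↦ (a, c)m`. -/
noncomputable def pairRight (q : A →ₗ[k] C →ₗ[k] k) (M : Type*) [AddCommGroup M] [Module k M]
    (a : A) : M ⊗[k] C →ₗ[k] M :=
  (TensorProduct.rid k M).toLinearMap ∘ₗ TensorProduct.map LinearMap.id (q a)

@[simp]
lemma pairLeft_tmul (q : A →ₗ[k] C →ₗ[k] k) (c : C) (a : A) (m : M) :
    pairLeft q M c (a ⊗ₜ m) = q a c • m := by
  simp [pairLeft]

@[simp]
lemma pairRight_tmul (q : A →ₗ[k] C →ₗ[k] k) (a : A) (m : M) (c : C) :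
    pairRight q M a (m ⊗ₜ c) = q a c • m := by
  simp [pairRight]

/-- The linear map `C → M`, `c ↦ (a, c)m`, attached to the tensor `a ⊗ m`. -/
noncomputable def pairHom (q : A →ₗ[k] C →ₗ[k] k) (x : A ⊗[k] M) : C →ₗ[k] M where
  toFun c := pairLeft q M c x
  map_add' c d := by
    induction x with
    | zero => simp
    | tmul a m => simp [add_smul]
    | add x y hx hy => simp only [map_add, hx, hy]; abel
  map_smul' r c := by
    induction x with
    | zero => simp
    | tmul a m => simp [mul_smul]
    | add x y hx hy => simp only [map_add, hx, hy, smul_add, RingHom.id_apply]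

@[simp]
lemma pairHom_apply (q : A →ₗ[k] C →ₗ[k] k) (x : A ⊗[k] M) (c : C) :
    pairHom q x c = pairLeft q M c x := rfl

lemma pairHom_tmul (q : A →ₗ[k] C →ₗ[k] k) (a : A) (m : M) :
    pairHom q (a ⊗ₜ m) = (q a).smulRight m := by
  ext c; simp

lemma pairHom_add (q : A →ₗ[k] C →ₗ[k] k) (x y : A ⊗[k] M) :
    pairHom q (x + y) = pairHom q x + pairHom q y := by
  ext c; simp

lemma pairHom_zero (q : A →ₗ[k] C →ₗ[k] k) :
    pairHom q (0 : A ⊗[k] M) = 0 := by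
  ext c; simp

lemma eq_iff_pairLeft_eq {q : A →ₗ[k] C →ₗ[k] k}
    (hnd : ∀ a : A, (∀ c : C, q a c = 0) → a = 0) {x y : A ⊗[k] M} :
    x = y ↔ ∀ c, pairLeft q M c x = pairLeft q M c y := by
  refine ⟨fun h _ => h ▸ rfl, fun h => ?_⟩
  classical
  let b := Module.Basis.ofVectorSpace k M
  apply (TensorProduct.equivFinsuppOfBasisRight (M := A) b).injective
  ext i
  refine sub_eq_zero.1 (hnd _ fun c => ?_)
  have key (z : A ⊗[k] M) : q (TensorProduct.equivFinsuppOfBasisRight (M := A) b z i) c =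
      b.coord i (pairLeft q M c z) := by
    induction z with
    | zero => simp
    | tmul a m => simp [mul_comm]
    | add x y hx hy => simp only [map_add, Finsupp.add_apply, LinearMap.add_apply, hx, hy]
  rw [map_sub, LinearMap.sub_apply, key, key, h, sub_self]

lemma eq_iff_pairRight_eq {q : A →ₗ[k] C →ₗ[k] k}
    (hnd : ∀ c : C, (∀ a : A, q a c = 0) → c = 0) {x y : M ⊗[k] C} :
    x = y ↔ ∀ a, pairRight q M a x = pairRight q M a y := by
  have key (a : A) (z : M ⊗[k] C) : pairLeft q.flip M a (TensorProduct.comm k M C z) =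
      pairRight q M a z := by
    induction z with
    | zero => simp
    | tmul m c => simp
    | add x y hx hy => simp only [map_add, hx, hy]
  rw [← (TensorProduct.comm k M C).injective.eq_iff, eq_iff_pairLeft_eq (q := q.flip) hnd]
  simp_rw [key]

lemma eq_iff_map_pairLeft_eq {q : A →ₗ[k] C →ₗ[k] k}
    (hnd : ∀ a : A, (∀ c : C, q a c = 0) → a = 0) {x y : (A ⊗[k] M) ⊗[k] N} :
    x = y ↔ ∀ c, TensorProduct.map (pairLeft q M c) LinearMap.id x =
      TensorProduct.map (pairLeft q M c) LinearMap.id y := by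
  have key (c : C) : TensorProduct.map (pairLeft q M c) (LinearMap.id : N →ₗ[k] N) =
      pairLeft q (M ⊗[k] N) c ∘ₗ (TensorProduct.assoc k A M N).toLinearMap := by
    ext; simp [TensorProduct.smul_tmul']
  rw [← (TensorProduct.assoc k A M N).injective.eq_iff, eq_iff_pairLeft_eq hnd]
  simp [key]

lemma eq_iff_map_pairRight_eq {q : A →ₗ[k] C →ₗ[k] k}
    (hnd : ∀ c : C, (∀ a : A, q a c = 0) → c = 0) {x y : M ⊗[k] (N ⊗[k] C)} :
    x = y ↔ ∀ a, TensorProduct.map LinearMap.id (pairRight q N a) x =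
      TensorProduct.map LinearMap.id (pairRight q N a) y := by
  have key (a : A) : TensorProduct.map (LinearMap.id : M →ₗ[k] M) (pairRight q N a) =
      pairRight q (M ⊗[k] N) a ∘ₗ (TensorProduct.assoc k M N C).symm.toLinearMap := by
    ext; simp
  rw [← (TensorProduct.assoc k M N C).symm.injective.eq_iff, eq_iff_pairRight_eq hnd]
  simp [key]

/-- The contraction `M ⊗ (C ⊗ C) → M`, `m ⊗ (c ⊗ d) ↦ (a, c)(b, d)m`. -/
noncomputable def pairRightTwo (q : A →ₗ[k] C →ₗ[k] k) (M : Type*) [AddCommGroup M]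
    [Module k M] (a b : A) : M ⊗[k] (C ⊗[k] C) →ₗ[k] M :=
  (TensorProduct.rid k M).toLinearMap ∘ₗ TensorProduct.map LinearMap.id
    ((TensorProduct.lid k k).toLinearMap ∘ₗ TensorProduct.map (q a) (q b))

@[simp]
lemma pairRightTwo_tmul (q : A →ₗ[k] C →ₗ[k] k) (a b : A) (m : M) (z : C ⊗[k] C) :
    pairRightTwo q M a b (m ⊗ₜ z) =
      TensorProduct.lid k k (TensorProduct.map (q a) (q b) z) • m := by
  simp [pairRightTwo]

lemma eq_iff_pairRightTwo_eq {q : A →ₗ[k] C →ₗ[k] k}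
    (hnd : ∀ c : C, (∀ a : A, q a c = 0) → c = 0) {x y : M ⊗[k] (C ⊗[k] C)} :
    x = y ↔ ∀ a b, pairRightTwo q M a b x = pairRightTwo q M a b y := by
  have key (a b : A) : pairRightTwo q M a b =
      pairRight q M a ∘ₗ TensorProduct.map LinearMap.id (pairRight q C b) := by
    ext; simp [smul_smul, mul_comm]
  rw [eq_iff_map_pairRight_eq hnd, forall_comm]
  simp_rw [eq_iff_pairRight_eq hnd (M := M) (C := C), key]
  rfl

end PairingSeparation

section PartialCoaction

variable {k H A C : Type*} [Field k] [Ring H] [Ring A] [Algebra k A]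
  [AddCommGroup C] [Module k C] {q : A →ₗ[k] C →ₗ[k] k}

lemma mul'_map_pairRight [Algebra k H] (a b : A) (z : (H ⊗[k] C) ⊗[k] (H ⊗[k] C)) :
    LinearMap.mul' k H (TensorProduct.map (pairRight q H a) (pairRight q H b) z) =
      pairRightTwo q H a b (TensorProduct.map (LinearMap.mul' k H) LinearMap.id
        (TensorProduct.tensorTensorTensorComm k H C H C z)) := by
  suffices h : LinearMap.mul' k H ∘ₗ
      TensorProduct.map (pairRight q H a) (pairRight q H b) =
      pairRightTwo q H a b ∘ₗ TensorProduct.map (LinearMap.mul' k H) LinearMap.id ∘ₗ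
        (TensorProduct.tensorTensorTensorComm k H C H C).toLinearMap from LinearMap.congr_fun h z
  ext
  simp [smul_smul, mul_comm]

lemma pairHom_eq_of_compat [Algebra k H] {lam : C →ₗ[k] H ⊗[k] C} {ρ : A →ₗ[k] A ⊗[k] H}
    (hcompat : ∀ a c, pairLeft q H c (ρ a) = pairRight q H a (lam c)) (a : A) :
    pairHom q (ρ a) = pairRight q H a ∘ₗ lam := by
  ext c
  exact hcompat a c

lemma map_pairLeft_map_coaction [Algebra k H] {lam : C →ₗ[k] H ⊗[k] C}
    {ρ : A →ₗ[k] A ⊗[k] H}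
    (hcompat : ∀ a c, pairLeft q H c (ρ a) = pairRight q H a (lam c)) (a : A) (c : C) :
    TensorProduct.map (pairLeft q H c) LinearMap.id
        (TensorProduct.map ρ LinearMap.id (ρ a)) =
      TensorProduct.map LinearMap.id (pairRight q H a)
        (TensorProduct.map LinearMap.id lam (lam c)) := by
  have left (x : A ⊗[k] H) : TensorProduct.map (pairLeft q H c) LinearMap.id
      (TensorProduct.map ρ LinearMap.id x) =
      TensorProduct.map LinearMap.id (pairHom q x) (lam c) := by
    induction x with
    | zero => simp [pairHom_zero]
    | add x y hx hy =>
      simp only [map_add, hx, hy, pairHom_add, TensorProduct.map_add_right,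
        LinearMap.add_apply]
    | tmul b h =>
      rw [TensorProduct.map_tmul, TensorProduct.map_tmul, hcompat, pairHom_tmul]
      induction lam c with
      | zero => simp
      | add z w hz hw => simp only [map_add, TensorProduct.add_tmul, ← hz, ← hw]
      | tmul g d => simp [TensorProduct.smul_tmul']
  rw [left, pairHom_eq_of_compat hcompat, TensorProduct.map_map, LinearMap.comp_id]

variable [Coalgebra k C]

lemma pairLeft_mul [Algebra k H] (hq : IsAlgCoalgPairing k q) (c : C) (x y : A ⊗[k] H) :
    pairLeft q H c (x * y) = LinearMap.mul' k H
      (TensorProduct.map (pairHom q x) (pairHom q y) (Coalgebra.comul (R := k) c)) := by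
  induction x with
  | zero => simp [pairHom_zero]
  | add x x' hx hx' =>
    simp only [add_mul, map_add, hx, hx', pairHom_add, TensorProduct.map_add_left,
      LinearMap.add_apply]
  | tmul a h =>
    induction y with
    | zero => simp [pairHom_zero]
    | add y y' hy hy' =>
      simp only [mul_add, map_add, hy, hy', pairHom_add, TensorProduct.map_add_right,
        LinearMap.add_apply]
    | tmul b g =>
      rw [Algebra.TensorProduct.tmul_mul_tmul, pairLeft_tmul, hq.pair_mul, pairHom_tmul,
        pairHom_tmul]
      induction Coalgebra.comul (R := k) c with
      | zero => simp
      | add z w hz hw => simp only [map_add, add_smul, hz, hw]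
      | tmul d e => simp [smul_smul, mul_comm]

lemma pairRight_mul [Algebra k H] (hq : IsAlgCoalgPairing k q) (a b : A) (z : H ⊗[k] C) :
    pairRight q H (a * b) z =
      pairRightTwo q H a b (TensorProduct.map LinearMap.id (Coalgebra.comul (R := k)) z) := by
  induction z with
  | zero => simp
  | add z w hz hw => simp only [map_add, hz, hw]
  | tmul h c => simp [hq.pair_mul]

lemma pairRight_one [Algebra k H] (hq : IsAlgCoalgPairing k q) :
    pairRight q H 1 = psiHC k := by
  ext h c
  simp [hq.pair_one, psiHC]

variable [Bialgebra k H]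

/-- The map `H ⊗ H → H ⊗ H`, `h ⊗ g ↦ h₍₁₎g ⊗ h₍₂₎`. -/
noncomputable def comulMulRight (k H : Type*) [Field k] [Ring H] [Bialgebra k H] :
    H ⊗[k] H →ₗ[k] H ⊗[k] H :=
  LinearMap.mul' k (H ⊗[k] H) ∘ₗ
    TensorProduct.map Coalgebra.comul ((TensorProduct.mk k H H).flip 1)

/-- The map `H ⊗ H → H ⊗ H`, `g ⊗ h ↦ gh₍₁₎ ⊗ h₍₂₎`. -/
noncomputable def comulMulLeft (k H : Type*) [Field k] [Ring H] [Bialgebra k H] :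
    H ⊗[k] H →ₗ[k] H ⊗[k] H :=
  LinearMap.mul' k (H ⊗[k] H) ∘ₗ
    TensorProduct.map ((TensorProduct.mk k H H).flip 1) Coalgebra.comul

@[simp]
lemma comulMulRight_tmul (h g : H) :
    comulMulRight k H (h ⊗ₜ g) = Coalgebra.comul (R := k) h * g ⊗ₜ[k] (1 : H) := by
  simp [comulMulRight]

@[simp]
lemma comulMulLeft_tmul (g h : H) :
    comulMulLeft k H (g ⊗ₜ h) = g ⊗ₜ[k] (1 : H) * Coalgebra.comul (R := k) h := by
  simp [comulMulLeft]

lemma map_pairLeft_comul_mul (hq : IsAlgCoalgPairing k q) (c : C) (x y : A ⊗[k] H) :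
    TensorProduct.map (pairLeft q H c) LinearMap.id
        ((TensorProduct.assoc k A H H).symm
          (TensorProduct.map LinearMap.id (Coalgebra.comul (R := k)) x) * y ⊗ₜ[k] (1 : H)) =
      comulMulRight k H
        (TensorProduct.map (pairHom q x) (pairHom q y) (Coalgebra.comul (R := k) c)) := by
  induction x with
  | zero => simp [pairHom_zero]
  | add x x' hx hx' =>
    simp only [add_mul, map_add, hx, hx', pairHom_add, TensorProduct.map_add_left,
      LinearMap.add_apply]
  | tmul a h =>
    induction y with
    | zero => simp [pairHom_zero]
    | add y y' hy hy' =>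
      simp only [mul_add, map_add, hy, hy', pairHom_add, TensorProduct.map_add_right,
        TensorProduct.add_tmul, LinearMap.add_apply]
    | tmul b g =>
      have left (t : H ⊗[k] H) : TensorProduct.map (pairLeft q H c) LinearMap.id
          ((TensorProduct.assoc k A H H).symm (a ⊗ₜ t) * (b ⊗ₜ g) ⊗ₜ[k] (1 : H)) =
          q (a * b) c • (t * g ⊗ₜ[k] (1 : H)) := by
        induction t with
        | zero => simp
        | add t s ht hs => simp only [TensorProduct.tmul_add, map_add, add_mul, ht, hs, smul_add]
        | tmul u v => simp [TensorProduct.smul_tmul']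
      rw [TensorProduct.map_tmul, LinearMap.id_apply, left, hq.pair_mul, pairHom_tmul,
        pairHom_tmul]
      induction Coalgebra.comul (R := k) c with
      | zero => simp
      | add z w hz hw => simp only [map_add, add_smul, hz, hw]
      | tmul d e => simp [smul_smul, mul_comm, ← TensorProduct.smul_tmul']

lemma map_pairLeft_mul_comul (hq : IsAlgCoalgPairing k q) (c : C) (x y : A ⊗[k] H) :
    TensorProduct.map (pairLeft q H c) LinearMap.id
        (y ⊗ₜ[k] (1 : H) * (TensorProduct.assoc k A H H).symm
          (TensorProduct.map LinearMap.id (Coalgebra.comul (R := k)) x)) =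
      comulMulLeft k H
        (TensorProduct.map (pairHom q y) (pairHom q x) (Coalgebra.comul (R := k) c)) := by
  induction x with
  | zero => simp [pairHom_zero]
  | add x x' hx hx' =>
    simp only [mul_add, map_add, hx, hx', pairHom_add, TensorProduct.map_add_right,
      LinearMap.add_apply]
  | tmul a h =>
    induction y with
    | zero => simp [pairHom_zero]
    | add y y' hy hy' =>
      simp only [add_mul, map_add, hy, hy', pairHom_add, TensorProduct.map_add_left,
        TensorProduct.add_tmul, LinearMap.add_apply]
    | tmul b g =>
      have left (t : H ⊗[k] H) : TensorProduct.map (pairLeft q H c) LinearMap.id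
          ((b ⊗ₜ g) ⊗ₜ[k] (1 : H) * (TensorProduct.assoc k A H H).symm (a ⊗ₜ t)) =
          q (b * a) c • (g ⊗ₜ[k] (1 : H) * t) := by
        induction t with
        | zero => simp
        | add t s ht hs => simp only [TensorProduct.tmul_add, map_add, mul_add, ht, hs, smul_add]
        | tmul u v => simp [TensorProduct.smul_tmul']
      rw [TensorProduct.map_tmul, LinearMap.id_apply, left, hq.pair_mul, pairHom_tmul,
        pairHom_tmul]
      induction Coalgebra.comul (R := k) c with
      | zero => simp
      | add z w hz hw => simp only [map_add, add_smul, hz, hw]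
      | tmul d e => simp [smul_smul, mul_comm, ← TensorProduct.smul_tmul']

lemma comulMulLeft_map_pairRight (a : A) (z : (H ⊗[k] C) ⊗[k] (H ⊗[k] C)) :
    comulMulLeft k H (TensorProduct.map (psiHC k) (pairRight q H a) z) =
      TensorProduct.map LinearMap.id (pairRight q H a)
        (mulFirst k (TensorProduct.map (psiHC k)
          ((TensorProduct.assoc k H H C).toLinearMap ∘ₗ
            TensorProduct.map (Coalgebra.comul (R := k)) LinearMap.id) z)) := by
  induction z with
  | zero => simp
  | add z w hz hw => simp only [map_add, hz, hw]
  | tmul u v =>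
    rw [TensorProduct.map_tmul, TensorProduct.map_tmul]
    generalize psiHC k u = g
    induction v with
    | zero => simp
    | add z w hz hw => simp only [map_add, TensorProduct.tmul_add, hz, hw]
    | tmul h c =>
      simp only [pairRight_tmul, LinearMap.comp_apply, TensorProduct.map_tmul,
        LinearMap.id_apply, TensorProduct.tmul_smul, map_smul, comulMulLeft_tmul]
      induction Coalgebra.comul (R := k) h with
      | zero => simp
      | add t s ht hs =>
        simp only [TensorProduct.add_tmul, TensorProduct.tmul_add, map_add, mul_add, smul_add,
          ht, hs]
      | tmul r s => simp [mulFirst]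

lemma comulMulRight_map_pairRight (a : A) (z : (H ⊗[k] C) ⊗[k] (H ⊗[k] C)) :
    comulMulRight k H (TensorProduct.map (pairRight q H a) (psiHC k) z) =
      TensorProduct.map LinearMap.id (pairRight q H a)
        (mulFirst k (TensorProduct.map LinearMap.id
          (TensorProduct.comm k (H ⊗[k] C) H).toLinearMap
          (TensorProduct.assoc k H (H ⊗[k] C) H
            (TensorProduct.map
              ((TensorProduct.assoc k H H C).toLinearMap ∘ₗ
                TensorProduct.map (Coalgebra.comul (R := k)) LinearMap.id) (psiHC k) z)))) := by
  induction z with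
  | zero => simp
  | add z w hz hw => simp only [map_add, hz, hw]
  | tmul v u =>
    rw [TensorProduct.map_tmul, TensorProduct.map_tmul]
    generalize psiHC k u = g
    induction v with
    | zero => simp
    | add z w hz hw => simp only [map_add, TensorProduct.add_tmul, hz, hw]
    | tmul h c =>
      simp only [pairRight_tmul, LinearMap.comp_apply, TensorProduct.map_tmul,
        LinearMap.id_apply, ← TensorProduct.smul_tmul', map_smul, comulMulRight_tmul]
      induction Coalgebra.comul (R := k) h with
      | zero => simp
      | add t s ht hs =>
        simp only [TensorProduct.add_tmul, map_add, add_mul, smul_add, ht, hs]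
      | tmul r s => simp [mulFirst]

end PartialCoaction

/-- Let `H` be a Hopf algebra and `(-,-) : A ⊗ C → k` a non-degenerate dual pairing between
a unital algebra `A` and a coalgebra `C`. Suppose `λ : C → H ⊗ C` and `ρ : A → A ⊗ H` are
linear maps satisfying `∑ (a⁽⁰⁾, c)a⁽¹⁾ = ∑ c⁽⁻¹⁾(a, c⁽⁰⁾)` in `H`. Then `ρ` makes `A` a
symmetric right partial `H`-comodule algebra if and only if `λ` makes `C` a symmetric left
partial `H`-comodule coalgebra. -/
theorem symmPartialComoduleAlgebra_iff_symmPartialComoduleCoalgebra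
    {k H A C : Type*} [Field k] [Ring H] [HopfAlgebra k H]
    [Ring A] [Algebra k A] [AddCommGroup C] [Module k C] [Coalgebra k C]
    (q : A →ₗ[k] C →ₗ[k] k) (hq : IsAlgCoalgPairing k q)
    (hnd₁ : ∀ a : A, (∀ c : C, q a c = 0) → a = 0)
    (hnd₂ : ∀ c : C, (∀ a : A, q a c = 0) → c = 0)
    (lam : C →ₗ[k] H ⊗[k] C) (ρ : A →ₗ[k] A ⊗[k] H)
    -- compatibility `∑ (a⁽⁰⁾, c)a⁽¹⁾ = ∑ c⁽⁻¹⁾(a, c⁽⁰⁾)`: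
    (hcompat : ∀ (a : A) (c : C),
      (TensorProduct.lid k H) (TensorProduct.map (q.flip c) LinearMap.id (ρ a)) =
      (TensorProduct.rid k H) (TensorProduct.map LinearMap.id (q a) (lam c))) :
    IsSymmRightPartialCoaction k ρ ↔
      (IsPartialComoduleCoalgebra k lam ∧ PLHCC3' k lam) := by
  change ∀ a c, pairLeft q H c (ρ a) = pairRight q H a (lam c) at hcompat
  have map_lam (a b : A) (c : C) :
      TensorProduct.map (pairHom q (ρ a)) (pairHom q (ρ b)) (Coalgebra.comul (R := k) c) =
        TensorProduct.map (pairRight q H a) (pairRight q H b)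
          (TensorProduct.map lam lam (Coalgebra.comul (R := k) c)) := by
    rw [pairHom_eq_of_compat hcompat, pairHom_eq_of_compat hcompat,
      TensorProduct.map_comp, LinearMap.comp_apply]
  have mul_iff : (∀ a b, ρ (a * b) = ρ a * ρ b) ↔ ∀ c,
      TensorProduct.map LinearMap.id (Coalgebra.comul (R := k)) (lam c) =
      TensorProduct.map (LinearMap.mul' k H) LinearMap.id
        ((TensorProduct.tensorTensorTensorComm k H C H C)
          (TensorProduct.map lam lam (Coalgebra.comul (R := k) c))) := by
    simp_rw [eq_iff_pairLeft_eq hnd₁, eq_iff_pairRightTwo_eq hnd₂, hcompat,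
      pairLeft_mul hq, pairRight_mul hq, map_lam, mul'_map_pairRight]
    exact ⟨fun h c a b => h a b c, fun h a b c => h c a b⟩
  have counit_iff : (∀ a, TensorProduct.rid k A
        (TensorProduct.map LinearMap.id Coalgebra.counit (ρ a)) = a) ↔
      ∀ c, TensorProduct.lid k C
        (TensorProduct.map Coalgebra.counit LinearMap.id (lam c)) = c := by
    have eq_iff_left (a b : A) : a = b ↔ ∀ c, q a c = q b c :=
      ⟨fun h _ => h ▸ rfl, fun h => sub_eq_zero.1 (hnd₁ _ fun c => by simp [h])⟩
    have eq_iff_right (c d : C) : c = d ↔ ∀ a, q a c = q a d :=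
      ⟨fun h _ => h ▸ rfl, fun h => sub_eq_zero.1 (hnd₂ _ fun a => by simp [h])⟩
    have left (c : C) (x : A ⊗[k] H) :
        q (TensorProduct.rid k A (TensorProduct.map LinearMap.id Coalgebra.counit x)) c =
          Coalgebra.counit (R := k) (pairLeft q H c x) := by
      induction x with
      | zero => simp
      | add x y hx hy => simp only [map_add, LinearMap.add_apply, hx, hy]
      | tmul a h => simp [mul_comm]
    have right (a : A) (z : H ⊗[k] C) :
        q a (TensorProduct.lid k C (TensorProduct.map Coalgebra.counit LinearMap.id z)) =
          Coalgebra.counit (R := k) (pairRight q H a z) := by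
      induction z with
      | zero => simp
      | add x y hx hy => simp only [map_add, hx, hy]
      | tmul h c => simp [mul_comm]
    simp_rw [eq_iff_left, eq_iff_right, left, right, hcompat]
    exact forall_comm
  have right_iff : (∀ a, TensorProduct.map ρ LinearMap.id (ρ a) =
      (TensorProduct.assoc k A H H).symm
        (TensorProduct.map LinearMap.id (Coalgebra.comul (R := k)) (ρ a)) *
          ρ 1 ⊗ₜ[k] (1 : H)) ↔ PLHCC3' k lam := by
    unfold PLHCC3'
    simp_rw [eq_iff_map_pairLeft_eq hnd₁, eq_iff_map_pairRight_eq hnd₂,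
      map_pairLeft_comul_mul hq, map_lam, pairRight_one hq,
      comulMulRight_map_pairRight, map_pairLeft_map_coaction hcompat]
    exact forall_comm
  have left_iff : (∀ a, TensorProduct.map ρ LinearMap.id (ρ a) =
      ρ 1 ⊗ₜ[k] (1 : H) * (TensorProduct.assoc k A H H).symm
        (TensorProduct.map LinearMap.id (Coalgebra.comul (R := k)) (ρ a))) ↔
      ∀ c, TensorProduct.map LinearMap.id lam (lam c) =
        mulFirst k (TensorProduct.map (psiHC k)
          ((TensorProduct.assoc k H H C).toLinearMap ∘ₗ
            TensorProduct.map (Coalgebra.comul (R := k)) LinearMap.id)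
          (TensorProduct.map lam lam (Coalgebra.comul (R := k) c))) := by
    simp_rw [eq_iff_map_pairLeft_eq hnd₁, eq_iff_map_pairRight_eq hnd₂,
      map_pairLeft_mul_comul hq, map_lam, pairRight_one hq,
      comulMulLeft_map_pairRight, map_pairLeft_map_coaction hcompat]
    exact forall_comm
  constructor
  · rintro ⟨h₁, h₂, h₃, h₄⟩
    exact ⟨⟨mul_iff.1 h₁, counit_iff.1 h₂, left_iff.1 h₄⟩, right_iff.1 h₃⟩
  · rintro ⟨⟨h₁, h₂, h₃⟩, h₃'⟩
    exact ⟨mul_iff.2 h₁, counit_iff.2 h₂, right_iff.2 h₃', left_iff.2 h₃⟩
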